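/- (Lemma, goal atoms become assumptions) Let H, G be goals and δ ∈ S'_P(H,G) with δ = ⟨(H,G),c₁,K₁,R₂,d₁⟩⟨R₂,c₂,K₂,R₃,d₂⟩…⟨R_n,c_n,∅,R_n,c_n⟩, where H = (H',H''), H'' ≠ ∅, and the first tuple of δ represents a derivation step using the Simplify' rule which rewrites exactly the atoms in (H'',G). Then the sequence δ' = ⟨H,c₁,K₁ ⊎ G,R₂,d₁⟩⟨R₂,c₂,K₂,R₃,d₂⟩…⟨R_n,c_n,∅,R_n,c_n⟩ belongs to S'_P(H). -/

import Mathlib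

/-!
A formalization of the syntax and (compositional) semantics of
Constraint Handling Rules (CHR), following Gabbrielli & Meo,
"A compositional trace semantics for CHR".
-/

noncomputable section

namespace CHR

attribute [local instance] Classical.propDecidable

/-- An abstract CHR language: variables, built-in constraints with a
first-order theory `CT` (given through the entailment relation `entails`),
and user-defined (CHR) atomic constraints. -/
structure Lang : Type 1 where
  /-- variables -/
  V : Type
  /-- built-in constraints -/
  B : Type
  /-- user-defined (CHR) atomic constraints -/
  U : Type
  fvB : B → Set V
  fvU : U → Set V
  /-- the empty (true) built-in constraint -/
  tt : B
  /-- the inconsistent built-in constraint `false` -/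
  ff : B
  /-- conjunction of built-in constraints -/
  and : B → B → B
  /-- the parameter-passing equation `H = H'` between multisets of user atoms -/
  eqC : Multiset U → Multiset U → B
  /-- existential quantification `∃_x` over a set of variables -/
  exQ : Set V → B → B
  /-- existential closure `∃_{-V}` except for the variables in the given set -/
  exNot : Set V → B → B
  /-- `CT ⊨ b → b'` -/
  entails : B → B → Prop
  entails_refl : ∀ b, entails b b
  entails_trans : ∀ {a b c}, entails a b → entails b c → entails a c
  entails_tt : ∀ b, entails b tt
  ff_entails : ∀ b, entails ff b
  tt_not_ff : ¬ entails tt ff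
  and_left : ∀ a b, entails (and a b) a
  and_right : ∀ a b, entails (and a b) b
  and_intro : ∀ {a b c}, entails a b → entails a c → entails a (and b c)
  entails_exQ : ∀ (x : Set V) b, entails b (exQ x b)
  eqC_refl : ∀ M, entails tt (eqC M M)
  /-- `eqAtom c a b` means `CT ⊨ c ∧ b ↔ c ∧ a`, for user-defined atoms `a`, `b` -/
  eqAtom : B → U → U → Prop
  eqAtom_refl : ∀ c a, eqAtom c a a

variable (L : Lang)

/-- `CT ⊨ b ↔ b'` -/
def Lang.eqv (b b' : L.B) : Prop := L.entails b b' ∧ L.entails b' b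

/-- a (built-in or user-defined) constraint -/
abbrev Constr := L.B ⊕ L.U
/-- a goal: a multiset of constraints -/
abbrev Goal := Multiset (Constr L)
/-- an indexed atom -/
abbrev IAtom := Constr L × ℕ
/-- a goal of indexed atoms -/
abbrev IGoal := Multiset (IAtom L)

def fvC : Constr L → Set L.V
  | Sum.inl b => L.fvB b
  | Sum.inr u => L.fvU u

/-- free variables of a (plain) goal -/
def fvGoal0 (G : Goal L) : Set L.V := {v | ∃ a ∈ G, v ∈ fvC L a}
/-- free variables of an indexed goal -/
def fvGoal (g : IGoal L) : Set L.V := {v | ∃ a ∈ g, v ∈ fvC L a.1}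
/-- free variables of a multiset of user-defined atoms -/
def fvUs (M : Multiset L.U) : Set L.V := {v | ∃ a ∈ M, v ∈ L.fvU a}

/-- a goal, with all its atoms indexed by `0` -/
def index0 (G : Goal L) : IGoal L := G.map (fun a => (a, 0))

/-- the maximal index occurring in an indexed goal -/
def maxIdx (g : IGoal L) : ℕ := ((g.map Prod.snd).toList).foldr max 0

/-- a CHR simplification rule `H ⇔ C | B` -/
structure Rule (L : Lang) where
  head : Multiset L.U
  guard : L.B
  body : Multiset (Constr L)

/-- a CHR program: a finite set of simplification rules -/
def Program (L : Lang) := {S : Set (Rule L) // S.Finite}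

/-- embedding of a multiset of indexed user atoms into an indexed goal -/
def embU (G0 : Multiset (L.U × ℕ)) : IGoal L := G0.map (fun p => (Sum.inr p.1, p.2))

/-! ### The compositional transition system -/

/-- the rule **Solve'** -/
def SolveStep (g : IGoal L) (c : L.B) (K : Multiset L.U) (g' : IGoal L) (d : L.B) : Prop :=
  K = 0 ∧ ∃ (cb : L.B) (i : ℕ) (G : IGoal L),
    g = (Sum.inl cb, i) ::ₘ G ∧ g' = G ∧ L.eqv (L.and cb c) d ∧
    L.fvB d ⊆ L.fvB cb ∪ L.fvB c

/-- the rule **Simplify'**, applied to the (nonempty) sub-multiset `G0` of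
user-defined atoms of the goal, with assumptions `K`. -/
def SimpStep (P : Program L) (G0 : Multiset (L.U × ℕ)) (g : IGoal L) (c : L.B)
    (K : Multiset L.U) (g' : IGoal L) (d : L.B) : Prop :=
  ∃ r ∈ P.1, ∃ A : IGoal L,
    G0 ≠ 0 ∧
    g = embU L G0 + A ∧
    r.head.card = G0.card + K.card ∧
    L.entails c (L.exQ (fvUs L r.head) (L.and (L.eqC r.head (G0.map Prod.fst + K)) r.guard)) ∧
    g' = r.body.map (fun a => (a, maxIdx L g + 1)) + A ∧
    d = L.and (L.eqC r.head (G0.map Prod.fst + K)) c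

/-- the labeled transition relation `⟨g,c⟩ →_P^K ⟨g',d⟩` -/
def Step (P : Program L) (g : IGoal L) (c : L.B) (K : Multiset L.U) (g' : IGoal L)
    (d : L.B) : Prop :=
  SolveStep L g c K g' d ∨ ∃ G0, SimpStep L P G0 g c K g' d

/-! ### Concrete sequences -/

/-- a tuple `⟨G,c,K,G',d⟩` of a concrete sequence -/
structure Tup (L : Lang) where
  g : IGoal L
  c : L.B
  k : Multiset L.U
  g' : IGoal L
  d : L.B

/-- `Seq`: concrete sequences of derivation steps, terminated by a tuple
`⟨G,c,∅,G,c⟩`, with `CT ⊨ c_{i+1} → d_i` between adjacent tuples. -/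
inductive IsSeq (P : Program L) : List (Tup L) → Prop
  | last (g : IGoal L) (c : L.B) : IsSeq P [⟨g, c, 0, g, c⟩]
  | step (t t' : Tup L) (rest : List (Tup L))
      (hstep : Step L P t.g t.c t.k t.g' t.d)
      (hlink : t'.g = t.g')
      (hmono : L.entails t'.c t.d)
      (htail : IsSeq P (t' :: rest)) : IsSeq P (t :: t' :: rest)

/-- `V_loc` of a single tuple -/
def VlocT (t : Tup L) : Set L.V :=
  (fvGoal L t.g' ∪ L.fvB t.d) \ (fvGoal L t.g ∪ L.fvB t.c ∪ fvUs L t.k)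

/-- all free variables of a tuple -/
def fvTup (t : Tup L) : Set L.V :=
  fvGoal L t.g ∪ L.fvB t.c ∪ fvUs L t.k ∪ fvGoal L t.g' ∪ L.fvB t.d

/-- `V_ass` of a concrete sequence -/
def VassC (δ : List (Tup L)) : Set L.V := {v | ∃ t ∈ δ, v ∈ fvUs L t.k}
/-- `V_stable` of a concrete sequence -/
def VstableC (δ : List (Tup L)) : Set L.V :=
  {v | ∃ t, δ.getLast? = some t ∧ v ∈ fvGoal L t.g}
/-- `V_constr` of a concrete sequence -/
def VconstrC (δ : List (Tup L)) : Set L.V := {v | ∃ t ∈ δ, v ∈ L.fvB t.d \ L.fvB t.c}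
/-- `V_loc` of a concrete sequence -/
def VlocC (δ : List (Tup L)) : Set L.V := {v | ∃ t ∈ δ, v ∈ VlocT L t}

/-- the set of input constraints of a concrete sequence -/
def IncC (δ : List (Tup L)) : Set L.B := {b | ∃ t ∈ δ, t.c = b}
/-- the set of assumption atoms of a concrete sequence -/
def AssC (δ : List (Tup L)) : Set L.U := {a | ∃ t ∈ δ, a ∈ t.k}
/-- the set of (user-defined) atoms of the last goal of a concrete sequence -/
def StableC (δ : List (Tup L)) : Set L.U :=
  {a | ∃ t, δ.getLast? = some t ∧ ∃ i : ℕ, (Sum.inr a, i) ∈ t.g}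

/-- compatibility of a tuple with a sequence of derivation steps -/
def Compatible (t : Tup L) (δ : List (Tup L)) : Prop :=
  (∀ t₂ ∈ δ.head?, L.entails t₂.c t.d) ∧
  VlocC L δ ∩ fvTup L t = ∅ ∧
  VlocT L t ∩ VassC L δ = ∅ ∧
  ∀ i (h : i < δ.length),
    VlocT L t ∩ L.fvB (δ.get ⟨i, h⟩).c ⊆
      (L.fvB t.d ∪ {v | ∃ t' ∈ δ.take i, v ∈ L.fvB t'.d}) ∪ VstableC L δ

/-- `S'_P`, the least fixpoint of `Φ` (as an inductive definition):
`SP' P g δ` means `δ ∈ S'_P(g)`. -/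
inductive SP' (P : Program L) : IGoal L → List (Tup L) → Prop
  | base (g : IGoal L) (c : L.B) : SP' P g [⟨g, c, 0, g, c⟩]
  | step (t : Tup L) (δ : List (Tup L))
      (hcons : ¬ L.eqv t.c L.ff)
      (hstep : Step L P t.g t.c t.k t.g' t.d)
      (htail : SP' P t.g' δ)
      (hcompat : Compatible L t δ)
      (hseq : IsSeq L P (t :: δ)) :
      SP' P t.g (t :: δ)

/-! ### Abstract sequences -/

/-- a tuple `⟨c,K,H,d⟩` of an abstract sequence -/
structure ATup (L : Lang) where
  c : L.B
  k : Multiset L.U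
  h : Multiset L.U
  d : L.B

/-- membership in the abstract semantic domain `D` -/
inductive InD : List (ATup L) → Prop
  | last (c : L.B) (h : Multiset L.U) : InD [⟨c, 0, h, c⟩]
  | cons (t t' : ATup L) (rest : List (ATup L))
      (hdc : L.entails t.d t.c)
      (hsub : t.h ≤ t'.h)
      (hmono : L.entails t'.c t.d)
      (htail : InD (t' :: rest)) : InD (t :: t' :: rest)

/-- the multiset of (user-defined, de-indexed) atoms of `g` which are stable in `δ` -/
def stableH (δ : List (Tup L)) (g : IGoal L) : Multiset L.U :=
  g.filterMap (fun a =>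
    match a.1 with
    | Sum.inl _ => none
    | Sum.inr u => if (∀ t ∈ δ, a ∈ t.g) then some u else none)

/-- the abstraction operator `α : Seq → D` -/
def alpha : List (Tup L) → List (ATup L)
  | [] => []
  | t :: δ => ⟨t.c, t.k, stableH L (t :: δ) t.g, t.d⟩ :: alpha δ

/-- `instore(σ)` -/
def instoreA (σ : List (ATup L)) : L.B :=
  match σ.head? with
  | some t => t.c
  | none => L.tt

/-- `store(σ)` -/
def storeA (σ : List (ATup L)) : L.B :=
  match σ.getLast? with
  | some t => t.d
  | none => L.tt

/-- the last stable multiset `H_n` of an abstract sequence -/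
def lastHA (σ : List (ATup L)) : Multiset L.U :=
  match σ.getLast? with
  | some t => t.h
  | none => 0

/-- connected abstract sequences -/
def Connected (σ : List (ATup L)) : Prop :=
  (∀ t ∈ σ, t.k = 0) ∧
  σ.Chain' (fun t t' => t.d = t'.c) ∧
  (lastHA L σ = 0 ∨ L.eqv (storeA L σ) L.ff)

/-- `V_ass` of an abstract sequence -/
def VassA (σ : List (ATup L)) : Set L.V := {v | ∃ t ∈ σ, v ∈ fvUs L t.k}
/-- `V_stable` of an abstract sequence -/
def VstableA (σ : List (ATup L)) : Set L.V := fvUs L (lastHA L σ)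
/-- `V_constr` of an abstract sequence -/
def VconstrA (σ : List (ATup L)) : Set L.V := {v | ∃ t ∈ σ, v ∈ L.fvB t.d \ L.fvB t.c}
/-- `V_loc` of an abstract sequence for a goal with free variables `fvG` -/
def VlocA (fvG : Set L.V) (σ : List (ATup L)) : Set L.V :=
  (VconstrA L σ ∪ VstableA L σ) \ (VassA L σ ∪ fvG)

/-- the set of assumption atoms of an abstract sequence -/
def AssA (σ : List (ATup L)) : Set L.U := {a | ∃ t ∈ σ, a ∈ t.k}
/-- the set of atoms of the last stable multiset of an abstract sequence -/
def StableA (σ : List (ATup L)) : Set L.U := {a | a ∈ lastHA L σ}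
/-- the set of input constraints of an abstract sequence -/
def IncA (σ : List (ATup L)) : Set L.B := {b | ∃ t ∈ σ, t.c = b}

/-- the compositional semantics `S_P(G) = α(S'_P(G))` -/
def Ssem (P : Program L) (G : Goal L) : Set (List (ATup L)) :=
  {σ | ∃ δ, SP' L P (index0 L G) δ ∧ alpha L δ = σ}

/-! ### The closure operator `η` and the composition operator `∥` -/

/-- the indexed stable multisets `H̃_i` of an abstract sequence -/
def tildeList : ℕ → Multiset (L.U × ℕ) → List (ATup L) → List (Multiset (L.U × ℕ))
  | _, _, [] => []
  | i, prev, t :: rest =>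
      (prev + (t.h - prev.map Prod.fst).map (fun u => (u, i))) ::
        tildeList (i + 1) (prev + (t.h - prev.map Prod.fst).map (fun u => (u, i))) rest

/-- `σ ∖ W`: remove the multiset `W` of indexed atoms from the (indexed)
stable multisets of `σ`, then remove the indexes -/
def seqSub (σ : List (ATup L)) (W : Multiset (L.U × ℕ)) : List (ATup L) :=
  (σ.zip (tildeList L 1 0 σ)).map (fun p => ⟨p.1.c, p.1.k, (p.2 - W).map Prod.fst, p.1.d⟩)

/-- the upper closure operator `η` (as a membership predicate:
`Eta S σ` iff `σ ∈ η(S)`) -/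
inductive Eta (S : Set (List (ATup L))) : List (ATup L) → Prop
  | base {σ : List (ATup L)} : σ ∈ S → Eta S σ
  | reduce (σ' σ'' : List (ATup L)) (c : L.B) (k h : Multiset L.U) (d : L.B)
      (K' : Multiset L.U) (W : Multiset (L.U × ℕ))
      (hmem : Eta S (σ' ++ ⟨c, k, h, d⟩ :: σ''))
      (hK : K' ≤ k)
      (hW : W ≤ (tildeList L 1 0 (σ' ++ (⟨c, k, h, d⟩ : ATup L) :: σ'')).getD σ'.length 0)
      (hrel : Multiset.Rel (fun (a : L.U) (w : L.U × ℕ) => L.eqAtom c a w.1) K' W) :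
      Eta S (seqSub L (σ' ++ ⟨c, k - K', h, d⟩ :: σ'') W)

/-- the raw interleaving underlying the composition operator `∥` on sequences -/
inductive Inter : List (ATup L) → List (ATup L) → List (ATup L) → Prop
  | last (c : L.B) (h1 h2 : Multiset L.U) :
      Inter [⟨c, 0, h1, c⟩] [⟨c, 0, h2, c⟩] [⟨c, 0, h1 + h2, c⟩]
  | left (t : ATup L) (σ₁ : List (ATup L)) (t₂ : ATup L) (σ₂' σ : List (ATup L))
      (hne : σ₁ ≠ [])
      (h : Inter σ₁ (t₂ :: σ₂') σ) :
      Inter (t :: σ₁) (t₂ :: σ₂') (⟨t.c, t.k, t.h + t₂.h, t.d⟩ :: σ)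
  | right (t₁ : ATup L) (σ₁' : List (ATup L)) (t : ATup L) (σ₂ σ : List (ATup L))
      (hne : σ₂ ≠ [])
      (h : Inter (t₁ :: σ₁') σ₂ σ) :
      Inter (t₁ :: σ₁') (t :: σ₂) (⟨t.c, t.k, t₁.h + t.h, t.d⟩ :: σ)

/-- the composition operator `∥` on (pairs of) abstract sequences -/
def ParSeq (σ₁ σ₂ : List (ATup L)) : Set (List (ATup L)) :=
  {σ | Inter L σ₁ σ₂ σ ∧ InD L σ}

/-- `σ₁ ∥ σ₂` is defined (for sequences of goals with free variables `fv₁`, `fv₂`) -/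
def ParDefinedV (fv₁ fv₂ : Set L.V) (σ₁ σ₂ : List (ATup L)) : Prop :=
  (VlocA L fv₁ σ₁ ∪ fv₁) ∩ (VlocA L fv₂ σ₂ ∪ fv₂) = fv₁ ∩ fv₂

/-- the composition operator `∥` on sets of abstract sequences (for goals with
free variables `fv₁`, `fv₂`) -/
def ParSet (fv₁ fv₂ : Set L.V) (S₁ S₂ : Set (List (ATup L))) : Set (List (ATup L)) :=
  {σ | ∃ σ₁ ∈ S₁, ∃ σ₂ ∈ S₂,
    ParDefinedV L fv₁ fv₂ σ₁ σ₂ ∧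
    Eta L (ParSeq L σ₁ σ₂) σ ∧
    (VlocA L fv₁ σ₁ ∪ VlocA L fv₂ σ₂) ∩ VassA L σ = ∅ ∧
    ∀ i (h : i < σ.length),
      (VlocA L fv₁ σ₁ ∪ VlocA L fv₂ σ₂) ∩ L.fvB (σ.get ⟨i, h⟩).c ⊆
        {v | ∃ t ∈ σ.take i, v ∈ L.fvB t.d} ∪ fvUs L (σ.get ⟨i, h⟩).h}

/-! ### The standard transition system and the data sufficient answers -/

/-- a configuration `⟨G,K,d⟩` of the standard transition system -/
structure Conf (L : Lang) where
  goal : Goal L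
  chr : Multiset L.U
  store : L.B

/-- the standard transition relation (rules **Solve**, **Introduce**, **Simplify**) -/
inductive StdStep (P : Program L) : Conf L → Conf L → Prop
  | solve (c : L.B) (G : Goal L) (K : Multiset L.U) (d d' : L.B)
      (h : L.eqv (L.and c d) d') (hfv : L.fvB d' ⊆ L.fvB c ∪ L.fvB d) :
      StdStep P ⟨Sum.inl c ::ₘ G, K, d⟩ ⟨G, K, d'⟩
  | introduce (u : L.U) (G : Goal L) (K : Multiset L.U) (d : L.B) :
      StdStep P ⟨Sum.inr u ::ₘ G, K, d⟩ ⟨G, u ::ₘ K, d⟩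
  | simplify (r : Rule L) (hr : r ∈ P.1) (H' : Multiset L.U) (G : Goal L)
      (K : Multiset L.U) (d : L.B)
      (hcard : H'.card = r.head.card)
      (hg : L.entails d (L.exQ (fvUs L r.head) (L.and (L.eqC r.head H') r.guard))) :
      StdStep P ⟨G, H' + K, d⟩ ⟨r.body + G, K, L.and (L.eqC r.head H') d⟩

/-- the data sufficient answers `SA_P(G)` of the standard semantics -/
def SA (P : Program L) (G : Goal L) : Set L.B :=
  {b | ∃ d, Relation.ReflTransGen (StdStep L P) ⟨G, 0, L.tt⟩ ⟨0, 0, d⟩ ∧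
        (¬ ∃ s', StdStep L P ⟨0, 0, d⟩ s') ∧ b = L.exNot (fvGoal0 L G) d} ∪
  {b | (∃ G' K d, Relation.ReflTransGen (StdStep L P) ⟨G, 0, L.tt⟩ ⟨G', K, d⟩ ∧
        L.eqv d L.ff) ∧ b = L.ff}

/-- the data sufficient answers `SA'_P(G)` computed by the compositional
transition system with empty assumptions -/
def SA' (P : Program L) (G : Goal L) : Set L.B :=
  {b | ∃ c, Relation.ReflTransGen
        (fun s s' : IGoal L × L.B => Step L P s.1 s.2 0 s'.1 s'.2)
        (index0 L G, L.tt) (0, c) ∧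
      (¬ ∃ K g' d, Step L P 0 c K g' d) ∧ b = L.exNot (fvGoal0 L G) c}

/-! ### Auxiliary operations on concrete sequences -/

/-- `δ ⊕ W`: add the (indexed) goal `W` to every goal component of `δ` -/
def oplus (δ : List (Tup L)) (W : IGoal L) : List (Tup L) :=
  δ.map (fun t => ⟨t.g + W, t.c, t.k, t.g' + W, t.d⟩)

/-- `δ ⊖ W`: remove the (indexed) goal `W` from every goal component of `δ` -/
def ominus (δ : List (Tup L)) (W : IGoal L) : List (Tup L) :=
  δ.map (fun t => ⟨t.g - W, t.c, t.k, t.g' - W, t.d⟩)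

/-- the operator `Φ` on interpretations -/
def Phi (P : Program L) (I : IGoal L → Set (List (Tup L))) :
    IGoal L → Set (List (Tup L)) := fun g =>
  {δ | ∃ t rest, δ = t :: rest ∧ t.g = g ∧ ¬ L.eqv t.c L.ff ∧
        Step L P t.g t.c t.k t.g' t.d ∧ rest ∈ I t.g' ∧ Compatible L t rest ∧
        IsSeq L P δ} ∪
  {δ | ∃ c : L.B, δ = [⟨g, c, 0, g, c⟩]}


lemma fvGoal_add (g g' : IGoal L) : fvGoal L (g + g') = fvGoal L g ∪ fvGoal L g' := by
  ext v
  simp only [fvGoal, Multiset.mem_add, Set.mem_ofPred_eq, Set.mem_union, or_and_right, exists_or]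

lemma fvUs_add (M N : Multiset L.U) : fvUs L (M + N) = fvUs L M ∪ fvUs L N := by
  ext v
  simp only [fvUs, Multiset.mem_add, Set.mem_ofPred_eq, Set.mem_union, or_and_right, exists_or]

lemma fvGoal_index0_map_inr (M : Multiset L.U) :
    fvGoal L (index0 L (M.map Sum.inr)) = fvUs L M := by
  ext v
  simp [fvGoal, fvUs, index0, fvC]

lemma index0_add (G G' : Goal L) : index0 L (G + G') = index0 L G + index0 L G' :=
  Multiset.map_add _ _ _

lemma embU_map_zero (M : Multiset L.U) :
    embU L (M.map (fun u => (u, 0))) = index0 L (M.map Sum.inr) := by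
  simp [embU, index0, Multiset.map_map]

lemma maxIdx_index0 (G : Goal L) : maxIdx L (index0 L G) = 0 := by
  have foldr_zero : ∀ l : List ℕ, (∀ n ∈ l, n = 0) → l.foldr max 0 = 0 := by
    intro l
    induction l with
    | nil => simp
    | cons a l ih =>
      intro h
      simp [h a (by simp), ih fun n hn => h n (by simp [hn])]
  refine foldr_zero _ fun n hn => ?_
  simp only [index0, Multiset.map_map, Multiset.mem_toList, Multiset.mem_map] at hn
  obtain ⟨a, -, rfl⟩ := hn
  rfl

/-- Atoms rewritten by a **Simplify'** step may be moved from the goal to the assumptions. -/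
lemma SimpStep.atoms_to_assumptions {L : Lang} {P : Program L} {H' : Goal L}
    {H'' G : Multiset L.U} {c d : L.B} {K : Multiset L.U} {g' : IGoal L} (hH'' : H'' ≠ 0)
    (h : SimpStep L P ((H'' + G).map (fun u => (u, 0)))
      (index0 L (H' + H''.map Sum.inr + G.map Sum.inr)) c K g' d) :
    SimpStep L P (H''.map (fun u => (u, 0))) (index0 L (H' + H''.map Sum.inr)) c (K + G) g' d := by
  obtain ⟨r, hr, A, -, hgA, hcard, hent, hg', hd⟩ := h
  have hA : A = index0 L H' := by
    rw [embU_map_zero, Multiset.map_add, add_assoc, index0_add _ H', add_comm] at hgA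
    exact (add_left_cancel hgA).symm
  have hatoms : (H''.map (fun u => (u, 0))).map Prod.fst + (K + G) =
      ((H'' + G).map (fun u => (u, 0))).map Prod.fst + K := by
    simp only [Multiset.map_map, Function.comp_def, Multiset.map_id']
    abel
  refine ⟨r, hr, A, by simpa using hH'', ?_, ?_, ?_, ?_, ?_⟩
  · rw [hA, embU_map_zero, index0_add, add_comm]
  · simp only [Multiset.card_map, Multiset.card_add] at hcard ⊢
    omega
  · rwa [hatoms]
  · rwa [maxIdx_index0] at hg' ⊢
  · rwa [hatoms]

/-- A **Simplify'** step rewriting atoms of index `0` only never leaves the goal unchanged. -/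
lemma SimpStep.goal_ne {L : Lang} {P : Program L} {G₀ : Multiset (L.U × ℕ)}
    {c d : L.B} {K : Multiset L.U} {g g' : IGoal L} (hzero : ∀ a ∈ G₀, a.2 = 0)
    (h : SimpStep L P G₀ g c K g' d) : g' ≠ g := by
  obtain ⟨r, -, A, hne, hgA, -, -, hg', -⟩ := h
  intro heq
  rw [hg'] at heq
  nth_rw 2 [hgA] at heq
  have hbody := add_right_cancel heq
  obtain ⟨a, ha⟩ := Multiset.exists_mem_of_ne_zero hne
  have hmem : ((Sum.inr a.1, a.2) : IAtom L) ∈ embU L G₀ :=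
    Multiset.mem_map_of_mem (fun p : L.U × ℕ => ((Sum.inr p.1, p.2) : IAtom L)) ha
  rw [← hbody] at hmem
  obtain ⟨b, -, hb⟩ := Multiset.mem_map.1 hmem
  have hidx := congrArg Prod.snd hb
  simp [hzero a ha] at hidx

/-- Compatibility depends on a tuple only through its right-hand side and the free variables of
its left-hand side. -/
lemma Compatible.of_fv_eq {L : Lang} {t s : Tup L} {δ : List (Tup L)} (h : Compatible L t δ)
    (hfv : fvGoal L s.g ∪ L.fvB s.c ∪ fvUs L s.k = fvGoal L t.g ∪ L.fvB t.c ∪ fvUs L t.k)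
    (hg' : s.g' = t.g') (hd : s.d = t.d) : Compatible L s δ := by
  have hloc : VlocT L s = VlocT L t := by simp only [VlocT, hfv, hg', hd]
  have htup : fvTup L s = fvTup L t := by simp only [fvTup, hfv, hg', hd]
  unfold Compatible at h ⊢
  rwa [hloc, htup, hd]

/-- **Lemma (goal atoms become assumptions).** If the first tuple of
`δ ∈ S'_P(H,G)` (with `H = (H',H'')`, `H'' ≠ ∅`) is a **Simplify'** step
rewriting exactly the atoms in `(H'',G)`, then the sequence obtained by
replacing the first goal by `H` and adding `G` to the assumptions of the
first tuple belongs to `S'_P(H)`. -/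
theorem goal_atoms_to_assumptions (L : Lang) (P : Program L)
    (H' : Goal L) (H'' G : Multiset L.U) (t : Tup L) (rest : List (Tup L))
    (hH'' : H'' ≠ 0)
    (hg : t.g = index0 L (H' + H''.map Sum.inr + G.map Sum.inr))
    (hsimp : SimpStep L P ((H'' + G).map (fun u => (u, 0))) t.g t.c t.k t.g' t.d)
    (hδ : SP' L P (index0 L (H' + H''.map Sum.inr + G.map Sum.inr)) (t :: rest)) :
    SP' L P (index0 L (H' + H''.map Sum.inr))
      (⟨index0 L (H' + H''.map Sum.inr), t.c, t.k + G, t.g', t.d⟩ :: rest) := by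
  generalize hI : index0 L (H' + H''.map Sum.inr + G.map Sum.inr) = I at hδ
  generalize hl : t :: rest = l at hδ
  cases hδ with
  | base g c =>
    obtain ⟨rfl, -⟩ := List.cons.inj hl
    refine absurd rfl (hsimp.goal_ne fun a ha => ?_)
    obtain ⟨u, -, rfl⟩ := Multiset.mem_map.1 ha
    rfl
  | step s δ hcons hstep htail hcompat hseq =>
    obtain ⟨rfl, rfl⟩ := List.cons.inj hl
    rw [hg] at hsimp
    have hstep' : Step L P (index0 L (H' + H''.map Sum.inr)) t.c (t.k + G) t.g' t.d :=
      Or.inr ⟨_, hsimp.atoms_to_assumptions hH''⟩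
    refine SP'.step ⟨index0 L (H' + H''.map Sum.inr), t.c, t.k + G, t.g', t.d⟩ rest
      hcons hstep' htail (hcompat.of_fv_eq ?_ rfl rfl) ?_
    · simp only [hg, index0_add, fvGoal_add, fvUs_add, fvGoal_index0_map_inr]
      ac_rfl
    · cases hseq with
      | last => nomatch htail
      | step _ t' rest' _ hlink hmono hrest =>
        exact IsSeq.step _ t' rest' hstep' hlink hmono hrest

end CHR
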